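/- arXiv:1606.05317 — 2 statements merged into one kernel-verified Lean document; each statement's English description precedes it below -/
import Mathlib

section
/- Consider a balanced urn model on a countable color set S with ergodic (irreducible, aperiodic, positive recurrent) stochastic replacement matrix R with stationary distribution π. Then the random urn configuration U_n/(n+1) converges in probability to π in the topology of weak convergence on probability measures on S, and the expected configuration E[U_n]/(n+1) converges weakly to π. -/
open MeasureTheory ProbabilityTheory Filter Classical

/-- The composition of a summable weight with a stochastic kernel, tested against a bounded
function, may be evaluated in either order. -/
theorem hasSum_comp_kernel_mul {S : Type*} {p : S → ℝ} {K : S → S → ℝ} {f : S → ℝ} {B : ℝ}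
    (hp : ∀ z, 0 ≤ p z) (hpsum : Summable p) (hK : ∀ z y, 0 ≤ K z y)
    (hKsum : ∀ z, HasSum (K z) 1) (hf : ∀ y, |f y| ≤ B) :
    HasSum (fun y => (∑' z, p z * K z y) * f y) (∑' z, p z * ∑' y, K z y * f y) := by
  have hpK : Summable (fun q : S × S => p q.1 * K q.1 q.2) := by
    have hrow : ∀ z, HasSum (fun y => p z * K z y) (p z) := fun z => by
      simpa using (hKsum z).mul_left (p z)
    refine (summable_prod_of_nonneg (fun q => mul_nonneg (hp q.1) (hK q.1 q.2))).2
      ⟨fun z => (hrow z).summable, ?_⟩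
    simpa only [(hrow _).tsum_eq] using hpsum
  have hF : Summable (fun q : S × S => p q.1 * K q.1 q.2 * f q.2) := by
    refine Summable.of_norm_bounded (hpK.mul_right B) fun q => ?_
    rw [Real.norm_eq_abs, abs_mul, abs_of_nonneg (mul_nonneg (hp _) (hK _ _))]
    exact mul_le_mul_of_nonneg_left (hf _) (mul_nonneg (hp _) (hK _ _))
  have hswap : Summable (fun y => ∑' z, p z * K z y * f y) := hF.prod_symm.prod
  have hcomm : ∑' y, ∑' z, p z * K z y * f y = ∑' z, ∑' y, p z * K z y * f y :=
    Summable.tsum_comm (f := fun z y => p z * K z y * f y) hF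
  have h := hswap.hasSum
  rw [hcomm] at h
  simp only [tsum_mul_right] at h
  simpa only [mul_assoc, tsum_mul_left] using h

section TransitionPowers

variable {S : Type*} {R : S → S → ℝ} {Rpow : ℕ → S → S → ℝ}

theorem transitionPow_nonneg (hR : ∀ x y, 0 ≤ R x y)
    (h0 : ∀ x y, Rpow 0 x y = if x = y then 1 else 0)
    (hsucc : ∀ n x y, Rpow (n + 1) x y = ∑' z, Rpow n x z * R z y) (n : ℕ) :
    ∀ x y, 0 ≤ Rpow n x y := by
  induction n with
  | zero => intro x y; rw [h0]; split_ifs <;> norm_num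
  | succ n ih => intro x y; rw [hsucc]; exact tsum_nonneg fun z => mul_nonneg (ih x z) (hR z y)

theorem transitionPow_hasSum (hR : ∀ x y, 0 ≤ R x y) (hRrow : ∀ x, HasSum (R x) 1)
    (h0 : ∀ x y, Rpow 0 x y = if x = y then 1 else 0)
    (hsucc : ∀ n x y, Rpow (n + 1) x y = ∑' z, Rpow n x z * R z y) (n : ℕ) :
    ∀ x, HasSum (Rpow n x) 1 := by
  induction n with
  | zero =>
    intro x
    have h := hasSum_single (f := Rpow 0 x) x (fun y hy => by rw [h0, if_neg hy.symm])
    rwa [h0, if_pos rfl] at h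
  | succ n ih =>
    intro x
    have h := hasSum_comp_kernel_mul (f := fun _ => 1) (B := 1)
      (transitionPow_nonneg hR h0 hsucc n x) (ih x).summable hR hRrow (by simp)
    simpa [(hRrow _).tsum_eq, (ih x).tsum_eq, ← hsucc] using h

theorem transitionPow_le_one (hR : ∀ x y, 0 ≤ R x y) (hRrow : ∀ x, HasSum (R x) 1)
    (h0 : ∀ x y, Rpow 0 x y = if x = y then 1 else 0)
    (hsucc : ∀ n x y, Rpow (n + 1) x y = ∑' z, Rpow n x z * R z y) (n : ℕ) (x y : S) :
    Rpow n x y ≤ 1 :=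
  le_hasSum (transitionPow_hasSum hR hRrow h0 hsucc n x) y
    fun z _ => transitionPow_nonneg hR h0 hsucc n x z

theorem transitionPow_one (h0 : ∀ x y, Rpow 0 x y = if x = y then 1 else 0)
    (hsucc : ∀ n x y, Rpow (n + 1) x y = ∑' z, Rpow n x z * R z y) (x y : S) :
    Rpow 1 x y = R x y := by
  rw [hsucc, tsum_eq_single x (fun z hz => by rw [h0, if_neg hz.symm, zero_mul])]
  simp [h0]

/-- The first-step decomposition of the transition powers. -/
theorem transitionPow_succ_eq (hR : ∀ x y, 0 ≤ R x y) (hRrow : ∀ x, HasSum (R x) 1)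
    (h0 : ∀ x y, Rpow 0 x y = if x = y then 1 else 0)
    (hsucc : ∀ n x y, Rpow (n + 1) x y = ∑' z, Rpow n x z * R z y) (n : ℕ) :
    ∀ x y, Rpow (n + 1) x y = ∑' z, R x z * Rpow n z y := by
  induction n with
  | zero =>
    intro x y
    rw [transitionPow_one h0 hsucc, tsum_eq_single y (fun z hz => by rw [h0, if_neg hz, mul_zero])]
    simp [h0]
  | succ n ih =>
    intro x y
    have hR1 : ∀ z, |R z y| ≤ 1 := fun z => by
      rw [abs_of_nonneg (hR z y)]
      exact le_hasSum (hRrow z) y fun w _ => hR z w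
    have h := hasSum_comp_kernel_mul (hR x) (hRrow x).summable
      (transitionPow_nonneg hR h0 hsucc n) (transitionPow_hasSum hR hRrow h0 hsucc n) hR1
    rw [hsucc, tsum_congr (fun z => by rw [ih x z]), h.tsum_eq]
    simp_rw [← hsucc]

theorem hasSum_mul_transitionPow_sub (hR : ∀ x y, 0 ≤ R x y) (hRrow : ∀ x, HasSum (R x) 1)
    (h0 : ∀ x y, Rpow 0 x y = if x = y then 1 else 0)
    (hsucc : ∀ n x y, Rpow (n + 1) x y = ∑' z, Rpow n x z * R z y) (c : ℝ) (n : ℕ) (x y : S) :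
    HasSum (fun z => R x z * (Rpow n z y - c)) (Rpow (n + 1) x y - c) := by
  have hs : Summable (fun z => R x z * Rpow n z y) :=
    Summable.of_nonneg_of_le
      (fun z => mul_nonneg (hR x z) (transitionPow_nonneg hR h0 hsucc n z y))
      (fun z => mul_le_of_le_one_right (hR x z) (transitionPow_le_one hR hRrow h0 hsucc n z y))
      (hRrow x).summable
  have h := hs.hasSum.sub ((hRrow x).mul_right c)
  rw [← transitionPow_succ_eq hR hRrow h0 hsucc, one_mul] at h
  simpa only [mul_sub] using h

end TransitionPowers

/-- A two-index sequence whose rows are perturbed running averages of the next row, and whose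
initial values vanish at infinity, tends to zero along each row. -/
theorem tendsto_zero_of_average_recursion {v : ℕ → ℕ → ℝ} (hv : ∀ n j, 0 ≤ v n j)
    (hrec : ∀ n j, v (n + 1) j ≤
      ((n + 1) * v n j + v n (j + 1)) / (n + 2) + 1 / (n + 2 : ℝ) ^ 2)
    (hlim : ∀ n, Tendsto (v n) atTop (nhds 0)) (j : ℕ) :
    Tendsto (fun n => v n j) atTop (nhds 0) := by
  have tail : ∀ ε > 0, ∃ J, ∀ j ≥ J, ∀ᶠ n in atTop, v n j ≤ ε := by
    intro ε hε
    obtain ⟨m, hm⟩ := exists_nat_one_div_lt (half_pos hε)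
    obtain ⟨J, hJ⟩ := eventually_atTop.1 ((hlim m).eventually (eventually_le_nhds (half_pos hε)))
    refine ⟨J, fun j hj => eventually_atTop.2 ⟨m, fun n hn => ?_⟩⟩
    have key : ∀ n ≥ m, ∀ j ≥ J, v n j ≤ ε / 2 + 1 / ((m : ℝ) + 1) - 1 / ((n : ℝ) + 1) := by
      intro n hn
      induction n, hn using Nat.le_induction with
      | base => intro j hj; simpa using hJ j hj
      | succ n hn ih =>
        intro j hj
        have h1 := ih j hj
        have h2 := ih (j + 1) (by omega)
        set c := ε / 2 + 1 / ((m : ℝ) + 1) - 1 / ((n : ℝ) + 1) with hc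
        have hn0 : (0 : ℝ) ≤ n := n.cast_nonneg
        have h3 : ((n + 1) * v n j + v n (j + 1)) / (n + 2) ≤ c := by
          rw [div_le_iff₀ (by positivity)]
          nlinarith
        have h4 : 1 / ((n : ℝ) + 2) ^ 2 ≤ 1 / ((n : ℝ) + 1) - 1 / ((n : ℝ) + 2) := by
          rw [div_sub_div _ _ (by positivity) (by positivity),
            div_le_div_iff₀ (by positivity) (by positivity)]
          nlinarith
        have h5 : (((n + 1 : ℕ) : ℝ) + 1) = (n : ℝ) + 2 := by push_cast; ring
        rw [h5]
        linarith [hrec n j]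
    have := key n hn j hj
    have : 0 ≤ 1 / ((n : ℝ) + 1) := by positivity
    linarith
  have step : ∀ ε, ∀ j, (∀ δ > ε, ∀ᶠ n in atTop, v n (j + 1) ≤ δ) →
      ∀ δ > ε, ∀ᶠ n in atTop, v n j ≤ δ := by
    intro ε j hnext δ hδ
    set η := (δ - ε) / 3 with hη
    have hη0 : 0 < η := by rw [hη]; linarith
    have hsmall := (tendsto_one_div_add_atTop_nhds_zero_nat (𝕜 := ℝ)).eventually
      (eventually_le_nhds hη0)
    obtain ⟨m, hm⟩ := eventually_atTop.1 ((hnext (ε + η) (by linarith)).and hsmall)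
    set C := (m + 1) * (v m j - (ε + 2 * η))
    have key : ∀ n ≥ m, (n + 1) * (v n j - (ε + 2 * η)) ≤ C := by
      intro n hn
      induction n, hn using Nat.le_induction with
      | base => exact le_rfl
      | succ n hn ih =>
        obtain ⟨h1, h2⟩ := hm n hn
        have hn0 : (0 : ℝ) ≤ n := n.cast_nonneg
        have h3 : (n + 2) * v (n + 1) j ≤ (n + 1) * v n j + v n (j + 1) + 1 / (n + 2 : ℝ) := by
          calc (n + 2) * v (n + 1) j ≤ (n + 2) * (((n + 1) * v n j + v n (j + 1)) / (n + 2)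
                + 1 / (n + 2 : ℝ) ^ 2) := mul_le_mul_of_nonneg_left (hrec n j) (by positivity)
            _ = _ := by field_simp
        have h4 : 1 / (n + 2 : ℝ) ≤ 1 / (n + 1 : ℝ) :=
          one_div_le_one_div_of_le (by positivity) (by linarith)
        push_cast
        nlinarith
    have hC : Tendsto (fun n : ℕ => C * (1 / ((n : ℝ) + 1))) atTop (nhds 0) := by
      simpa using (tendsto_one_div_add_atTop_nhds_zero_nat (𝕜 := ℝ)).const_mul C
    filter_upwards [eventually_ge_atTop m, hC.eventually (eventually_le_nhds hη0)] with n hn hn'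
    have h1 : v n j - (ε + 2 * η) ≤ C * (1 / ((n : ℝ) + 1)) := by
      rw [mul_one_div, le_div_iff₀ (by positivity), mul_comm]
      exact key n hn
    linarith
  have all : ∀ ε > 0, ∀ δ > ε, ∀ j, ∀ᶠ n in atTop, v n j ≤ δ := by
    intro ε hε δ hδ j
    obtain ⟨J, hJ⟩ := tail ε hε
    have down : ∀ k j, J ≤ j + k → ∀ δ > ε, ∀ᶠ n in atTop, v n j ≤ δ := by
      intro k
      induction k with
      | zero => intro j hj δ hδ; exact (hJ j hj).mono fun n hn => hn.trans hδ.le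
      | succ k ih => intro j hj; exact step ε j (ih (j + 1) (by omega))
    exact down J j (by omega) δ hδ
  refine tendsto_order.2 ⟨fun a ha => .of_forall fun n => ha.trans_le (hv n j), fun a ha => ?_⟩
  filter_upwards [all (a / 3) (by linarith) (a / 2) (by linarith) j] with n hn
  linarith

section Urn

variable {S : Type*} {R : S → S → ℝ} {Ω : Type*} {Z : ℕ → Ω → S} {u0 : S → ℝ}
  {U : ℕ → Ω → S → ℝ}

theorem urn_eq_sum (hU0 : ∀ ω, U 0 ω = u0)
    (hUrec : ∀ n ω s, U (n + 1) ω s = U n ω s + R (Z n ω) s) (n : ℕ) (ω : Ω) (s : S) :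
    U n ω s = u0 s + ∑ k ∈ Finset.range n, R (Z k ω) s := by
  induction n with
  | zero => simp [hU0]
  | succ n ih => rw [hUrec, ih, Finset.sum_range_succ, add_assoc]

theorem urn_hasSum_mul {f g : S → ℝ} {c : ℝ} (hU0 : ∀ ω, U 0 ω = u0)
    (hUrec : ∀ n ω s, U (n + 1) ω s = U n ω s + R (Z n ω) s)
    (hu0 : HasSum (fun t => u0 t * f t) c) (hR : ∀ x, HasSum (fun t => R x t * f t) (g x))
    (n : ℕ) (ω : Ω) :
    HasSum (fun t => U n ω t * f t) (c + ∑ k ∈ Finset.range n, g (Z k ω)) := by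
  simp_rw [urn_eq_sum hU0 hUrec, add_mul, Finset.sum_mul]
  exact hu0.add (hasSum_sum fun k _ => hR _)

theorem urn_nonneg (hR : ∀ x y, 0 ≤ R x y) (hu0 : ∀ s, 0 ≤ u0 s) (hU0 : ∀ ω, U 0 ω = u0)
    (hUrec : ∀ n ω s, U (n + 1) ω s = U n ω s + R (Z n ω) s) (n : ℕ) (ω : Ω) (s : S) :
    0 ≤ U n ω s := by
  rw [urn_eq_sum hU0 hUrec]
  exact add_nonneg (hu0 s) (Finset.sum_nonneg fun k _ => hR _ _)

theorem urn_hasSum (hRrow : ∀ x, HasSum (R x) 1) (hu0sum : HasSum u0 1)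
    (hU0 : ∀ ω, U 0 ω = u0) (hUrec : ∀ n ω s, U (n + 1) ω s = U n ω s + R (Z n ω) s)
    (n : ℕ) (ω : Ω) : HasSum (U n ω) (n + 1) := by
  have h := urn_hasSum_mul (f := fun _ => 1) (g := fun _ => 1) (c := 1) hU0 hUrec
    (by simpa using hu0sum) (fun x => by simpa using hRrow x) n ω
  simpa [add_comm] using h

variable [Countable S] [MeasurableSpace S] [MeasurableSingletonClass S]

theorem measurable_comp_past (g : S → ℝ) {n k : ℕ} (hk : k ∈ Finset.range n) :
    Measurable[⨆ k ∈ Finset.range n, MeasurableSpace.comap (Z k) inferInstance]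
      (fun ω => g (Z k ω)) :=
  Measurable.mono ((measurable_of_countable g).comp (comap_measurable (Z k)))
    (le_iSup₂_of_le k hk le_rfl) le_rfl

theorem measurable_past_sum (g : S → ℝ) (c : ℝ) (n : ℕ) :
    Measurable[⨆ k ∈ Finset.range n, MeasurableSpace.comap (Z k) inferInstance]
      (fun ω => c + ∑ k ∈ Finset.range n, g (Z k ω)) :=
  Measurable.const_add
    (Finset.measurable_fun_sum _ fun _ hk => measurable_comp_past g hk) c

end Urn

/-- If `P` is the conditional law of the discrete variable `Y` given `F`, then the conditional
expectation of `g ∘ Y` is the `P`-average of `g`, tested against bounded `F`-measurable `W`. -/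
theorem integral_mul_comp_eq_of_conditional_law {S Ω : Type*} [Countable S] [MeasurableSpace S]
    [MeasurableSingletonClass S] {F : MeasurableSpace Ω} [mΩ : MeasurableSpace Ω] {μ : Measure Ω}
    [IsProbabilityMeasure μ] (hFle : F ≤ mΩ) {Y : Ω → S} (hY : Measurable Y) {P : S → Ω → ℝ}
    (hPm : ∀ s, Measurable[F] (P s)) (hPnn : ∀ s ω, 0 ≤ P s ω)
    (hPsum : ∀ ω, HasSum (fun s => P s ω) 1)
    (hdraw : ∀ s : S, ∀ A : Set Ω, MeasurableSet[F] A →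
      (μ (A ∩ {ω | Y ω = s})).toReal = ∫ ω in A, P s ω ∂μ)
    {W X : Ω → ℝ} {g : S → ℝ} {C : ℝ} (hW : Measurable[F] W) (hW1 : ∀ ω, |W ω| ≤ C)
    (hg : ∀ s, |g s| ≤ 1) (hX : ∀ ω, HasSum (fun s => P s ω * g s) (X ω)) :
    ∫ ω, W ω * g (Y ω) ∂μ = ∫ ω, W ω * X ω ∂μ := by
  have hWm : Measurable W := hW.mono hFle le_rfl
  set I : S → Ω → ℝ := fun s => Set.indicator {ω | Y ω = s} 1 with hI
  have hYs : ∀ s, MeasurableSet {ω | Y ω = s} := fun s => hY (measurableSet_singleton s)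
  have hI0 : ∀ ω s, s ≠ Y ω → I s ω = 0 := fun ω s hs =>
    Set.indicator_of_notMem (s := {ω | Y ω = s}) (fun h => hs (Eq.symm h)) _
  have hIsum : ∀ ω, HasSum (fun s => I s ω) 1 := fun ω => by
    simpa [hI] using hasSum_single (f := fun s => I s ω) (Y ω) (hI0 ω)
  have hInn : ∀ s ω, 0 ≤ I s ω := fun s ω => Set.indicator_nonneg (by simp) ω
  have hI1 : ∀ s ω, I s ω ≤ 1 := fun s ω => le_hasSum (hIsum ω) s fun t _ => hInn t ω
  have hP1 : ∀ s ω, P s ω ≤ 1 := fun s ω => le_hasSum (hPsum ω) s fun t _ => hPnn t ω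
  have hIm : ∀ s, Measurable (I s) := fun s => measurable_one.indicator (hYs s)
  have hPm' : ∀ s, Measurable (P s) := fun s => (hPm s).mono hFle le_rfl
  have hIint : ∀ s, Integrable (I s) μ := fun s =>
    .of_bound (hIm s).aestronglyMeasurable 1
      (.of_forall fun ω => by rw [Real.norm_of_nonneg (hInn s ω)]; exact hI1 s ω)
  have hPint : ∀ s, Integrable (P s) μ := fun s =>
    .of_bound (hPm' s).aestronglyMeasurable 1
      (.of_forall fun ω => by rw [Real.norm_of_nonneg (hPnn s ω)]; exact hP1 s ω)
  have hWI : ∀ s, Integrable (W * I s) μ := fun s =>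
    (hIint s).bdd_mul hWm.aestronglyMeasurable (.of_forall hW1)
  have hcond : ∀ s, P s =ᵐ[μ] μ[I s|F] := fun s => by
    refine ae_eq_condExp_of_forall_setIntegral_eq hFle (hIint s)
      (fun A _ _ => (hPint s).integrableOn) (fun A hA _ => ?_)
      (hPm s).stronglyMeasurable.aestronglyMeasurable
    rw [← hdraw s A hA, integral_indicator_one (hYs s), measureReal_restrict_apply (hYs s),
      Set.inter_comm]
    rfl
  have hsingle : ∀ s, ∫ ω, W ω * I s ω ∂μ = ∫ ω, W ω * P s ω ∂μ := fun s => by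
    have h1 : μ[W * I s|F] =ᵐ[μ] W * μ[I s|F] :=
      condExp_mul_of_stronglyMeasurable_left hW.stronglyMeasurable (hWI s) (hIint s)
    have h2 : ∫ ω, (W * I s) ω ∂μ = ∫ ω, (μ[W * I s|F]) ω ∂μ := (integral_condExp hFle).symm
    refine h2.trans (integral_congr_ae ?_)
    filter_upwards [h1, hcond s] with ω h1 h2
    rw [h1, Pi.mul_apply, h2]
  have dominated : ∀ (Q : S → Ω → ℝ) (L : Ω → ℝ), (∀ s, Measurable (Q s)) →
      (∀ s ω, 0 ≤ Q s ω) → (∀ ω, HasSum (fun s => Q s ω) 1) →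
      (∀ ω, HasSum (fun s => Q s ω * g s) (L ω)) →
      HasSum (fun s => ∫ ω, W ω * (Q s ω * g s) ∂μ) (∫ ω, W ω * L ω ∂μ) := by
    intro Q L hQm hQ hQsum hL
    refine hasSum_integral_of_dominated_convergence (fun s ω => C * Q s ω)
      (fun s => (hWm.mul ((hQm s).mul_const _)).aestronglyMeasurable)
      (fun s => .of_forall fun ω => ?_) (.of_forall fun ω => (hQsum ω).summable.mul_left C) ?_
      (.of_forall fun ω => (hL ω).mul_left _)
    · rw [Real.norm_eq_abs, abs_mul, abs_mul, abs_of_nonneg (hQ s ω)]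
      exact mul_le_mul (hW1 ω) (mul_le_of_le_one_right (hQ s ω) (hg s))
        (by have := hQ s ω; positivity) ((abs_nonneg _).trans (hW1 ω))
    · simp [tsum_mul_left, (hQsum _).tsum_eq]
  have hA := dominated I (fun ω => g (Y ω)) hIm hInn hIsum fun ω => by
    have h := hasSum_single (f := fun s => I s ω * g s) (Y ω)
      (fun s hs => by simp [hI0 ω s hs])
    simpa [hI] using h
  have hB := dominated P X hPm' hPnn hPsum hX
  refine hA.unique ?_
  convert hB using 2 with s
  simp_rw [← mul_assoc, integral_mul_const, hsingle]

/-- Balanced urn on a countable color set `S` with ergodic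
stochastic replacement matrix `R` having stationary distribution `π`.  The urn
evolves by `U (n+1) ω s = U n ω s + R (Z n ω) s` where, conditionally on the
past, `Z n` is drawn from `U n / (n+1)`.  Ergodicity is expressed by the
convergence of the `n`-step transition probabilities `Rpow n x y → π y` for
every starting state `x`.  Then the random configuration `U n / (n+1)`
converges in probability to `π` pointwise on colors (which on a countable
discrete space is weak convergence), and the expected configuration
`E[U n] / (n+1)` converges to `π`. -/
theorem ergodic_urn_convergence
    {S : Type*} [Countable S] [MeasurableSpace S] [MeasurableSingletonClass S]
    (R : S → S → ℝ) (hRnonneg : ∀ x y, 0 ≤ R x y) (hRrow : ∀ x, HasSum (R x) 1)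
    (π : S → ℝ) (hπnonneg : ∀ y, 0 ≤ π y) (hπsum : HasSum π 1)
    (hπstat : ∀ y, HasSum (fun x => π x * R x y) (π y))
    (Rpow : ℕ → S → S → ℝ)
    (hRpow0 : ∀ x y, Rpow 0 x y = if x = y then 1 else 0)
    (hRpowsucc : ∀ n x y, Rpow (n + 1) x y = ∑' z, Rpow n x z * R z y)
    (hergodic : ∀ x y, Tendsto (fun n => Rpow n x y) atTop (nhds (π y)))
    {Ω : Type*} [MeasurableSpace Ω] (μ : Measure Ω) [IsProbabilityMeasure μ]
    (Z : ℕ → Ω → S) (hZmeas : ∀ n, Measurable (Z n))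
    (u0 : S → ℝ) (hu0nonneg : ∀ s, 0 ≤ u0 s) (hu0sum : HasSum u0 1)
    (U : ℕ → Ω → S → ℝ)
    (hU0 : ∀ ω, U 0 ω = u0)
    (hUrec : ∀ n ω s, U (n + 1) ω s = U n ω s + R (Z n ω) s)
    (hdraw : ∀ n : ℕ, ∀ s : S, ∀ A : Set Ω,
      MeasurableSet[⨆ k ∈ Finset.range n, MeasurableSpace.comap (Z k) inferInstance] A →
      (μ (A ∩ {ω | Z n ω = s})).toReal = ∫ ω in A, U n ω s / (n + 1 : ℝ) ∂μ) :
    (∀ s : S,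
      TendstoInMeasure μ (fun (n : ℕ) (ω : Ω) => U n ω s / (n + 1 : ℝ))
        atTop (fun _ => π s)) ∧
    (∀ s : S,
      Tendsto (fun n : ℕ => (∫ ω, U n ω s ∂μ) / (n + 1 : ℝ)) atTop (nhds (π s))) := by
  have hU_past : ∀ n s,
      Measurable[⨆ k ∈ Finset.range n, MeasurableSpace.comap (Z k) inferInstance]
        (fun ω => U n ω s) := fun n s => by
    simp_rw [urn_eq_sum hU0 hUrec]
    exact measurable_past_sum (fun x => R x s) (u0 s) n
  have hpast : ∀ n, (⨆ k ∈ Finset.range n, MeasurableSpace.comap (Z k) inferInstance) ≤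
      ‹MeasurableSpace Ω› := fun n => iSup₂_le fun k _ => (hZmeas k).comap_le
  have hUnn := urn_nonneg hRnonneg hu0nonneg hU0 hUrec
  have hUsum := urn_hasSum hRrow hu0sum hU0 hUrec
  have L2 : ∀ s : S, Tendsto (fun n : ℕ => ∫ ω, (U n ω s / (n + 1 : ℝ) - π s) ^ 2 ∂μ)
      atTop (nhds 0) := by
    intro s
    set h : ℕ → S → ℝ := fun j x => Rpow j x s - π s with hh
    have hπ1 : π s ≤ 1 := le_hasSum hπsum s fun t _ => hπnonneg t
    have hbd : ∀ j x, |h j x| ≤ 1 := fun j x => by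
      have h1 := transitionPow_nonneg hRnonneg hRpow0 hRpowsucc j x s
      have h2 := transitionPow_le_one hRnonneg hRrow hRpow0 hRpowsucc j x s
      have h3 := hπnonneg s
      rw [abs_le]
      constructor <;> simp only [hh] <;> linarith
    have hstep : ∀ j x, HasSum (fun t => R x t * h j t) (h (j + 1) x) := fun j x =>
      hasSum_mul_transitionPow_sub hRnonneg hRrow hRpow0 hRpowsucc (π s) j x s
    have hlim : ∀ x, Tendsto (fun j => h j x) atTop (nhds 0) := fun x => by
      simpa using (hergodic x s).sub_const (π s)
    have hu0b : ∀ j t, ‖u0 t * h j t‖ ≤ u0 t := fun j t => by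
      rw [norm_mul, Real.norm_of_nonneg (hu0nonneg t)]
      exact mul_le_of_le_one_right (hu0nonneg t) (hbd j t)
    set c : ℕ → ℝ := fun j => ∑' t, u0 t * h j t with hc
    have hcsum : ∀ j, HasSum (fun t => u0 t * h j t) (c j) := fun j =>
      (Summable.of_norm_bounded hu0sum.summable (hu0b j)).hasSum
    have hc1 : ∀ j, |c j| ≤ 1 := fun j => by
      have := tsum_of_norm_bounded hu0sum (hu0b j)
      simpa using this
    have hclim : Tendsto c atTop (nhds 0) := by
      have := tendsto_tsum_of_dominated_convergence (𝓕 := atTop) (g := fun _ : S => (0 : ℝ))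
        hu0sum.summable (fun t => by simpa using (hlim t).const_mul (u0 t))
        (.of_forall fun j t => hu0b j t)
      simpa using this
    set x : ℕ → ℕ → Ω → ℝ := fun n j ω =>
      (c j + ∑ k ∈ Finset.range n, h (j + 1) (Z k ω)) / (n + 1) with hx
    have hxeq : ∀ n j ω, (n + 1) * x n j ω =
        c j + ∑ k ∈ Finset.range n, h (j + 1) (Z k ω) := fun n j ω => by
      simp only [hx]; field_simp
    have hxsum : ∀ n j ω, HasSum (fun t => U n ω t * h j t) ((n + 1) * x n j ω) :=
      fun n j ω => by
        rw [hxeq]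
        exact urn_hasSum_mul hU0 hUrec (hcsum j) (hstep j) n ω
    have hxrec : ∀ n j ω, (n + 2) * x (n + 1) j ω = (n + 1) * x n j ω + h (j + 1) (Z n ω) :=
      fun n j ω => by
        have h1 := hxeq (n + 1) j ω
        rw [Finset.sum_range_succ, ← add_assoc, ← hxeq] at h1
        rw [← h1]; push_cast; ring
    have hx1 : ∀ n j ω, |x n j ω| ≤ 1 := fun n j ω => by
      have hn : (0 : ℝ) < n + 1 := by positivity
      simp only [hx]
      rw [abs_div, abs_of_pos hn, div_le_one hn]
      calc |c j + ∑ k ∈ Finset.range n, h (j + 1) (Z k ω)|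
          ≤ |c j| + ∑ k ∈ Finset.range n, |h (j + 1) (Z k ω)| :=
            (abs_add_le _ _).trans (by gcongr; exact Finset.abs_sum_le_sum_abs _ _)
        _ ≤ 1 + ∑ k ∈ Finset.range n, 1 := by gcongr; exacts [hc1 j, hbd _ _]
        _ = n + 1 := by simp [add_comm]
    have hxF : ∀ n j,
        Measurable[⨆ k ∈ Finset.range n, MeasurableSpace.comap (Z k) inferInstance] (x n j) :=
      fun n j => (measurable_past_sum (h (j + 1)) (c j) n).div_const _
    have hxm : ∀ n j, Measurable (x n j) := fun n j =>
      (hxF n j).mono (hpast n) le_rfl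
    have hxlim : ∀ n ω, Tendsto (fun j => x n j ω) atTop (nhds 0) := fun n ω => by
      have h1 := (hclim.add (tendsto_finsetSum (Finset.range n) fun k _ =>
        (hlim (Z k ω)).comp (tendsto_add_atTop_nat 1))).div_const ((n : ℝ) + 1)
      simpa using h1
    have hbdint : ∀ f : Ω → ℝ, Measurable f → (∀ ω, |f ω| ≤ 1) → Integrable f μ :=
      fun f hf hf1 => .of_bound hf.aestronglyMeasurable 1 (.of_forall hf1)
    have hsq1 : ∀ a : ℝ, |a| ≤ 1 → |a ^ 2| ≤ 1 := fun a ha => by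
      rw [abs_pow]; exact pow_le_one₀ (abs_nonneg a) ha
    have hsqint : ∀ n j, Integrable (fun ω => x n j ω ^ 2) μ := fun n j =>
      hbdint _ ((hxm n j).pow_const 2) fun ω => hsq1 _ (hx1 n j ω)
    have hgm : ∀ n j, Measurable fun ω => h j (Z n ω) := fun n j =>
      (measurable_of_countable (h j)).comp (hZmeas n)
    have main := tendsto_zero_of_average_recursion (v := fun n j => ∫ ω, x n j ω ^ 2 ∂μ)
      (fun n j => integral_nonneg fun ω => sq_nonneg _) (fun n j => ?_) (fun n => ?_) 0
    · have hx0 : ∀ n ω, x n 0 ω = U n ω s / (n + 1 : ℝ) - π s := fun n ω => by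
        have hn : (n : ℝ) + 1 ≠ 0 := by positivity
        have hc0 : c 0 = u0 s - π s := by
          have h1 : HasSum (fun t => u0 t * Rpow 0 t s) (u0 s) := by
            have := hasSum_single (f := fun t => u0 t * Rpow 0 t s) s
              (fun t ht => by simp [hRpow0, ht])
            simpa [hRpow0] using this
          have h2 := h1.sub (hu0sum.mul_right (π s))
          simp only [← mul_sub, one_mul] at h2
          exact h2.tsum_eq
        simp only [hx, hh, zero_add, hc0, transitionPow_one hRpow0 hRpowsucc,
          urn_eq_sum hU0 hUrec, Finset.sum_sub_distrib, Finset.sum_const, Finset.card_range,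
          nsmul_eq_mul]
        field_simp
        ring
      simpa only [hx0] using main
    · have hcross : ∫ ω, x n j ω * h (j + 1) (Z n ω) ∂μ = ∫ ω, x n j ω * x n (j + 1) ω ∂μ := by
        have hn : (0 : ℝ) < n + 1 := by positivity
        refine integral_mul_comp_eq_of_conditional_law (hpast n) (hZmeas n)
          (P := fun t ω => U n ω t / (n + 1)) (fun t => (hU_past n t).div_const _)
          (fun t ω => div_nonneg (hUnn n ω t) hn.le) (fun ω => ?_) (hdraw n)
          (hxF n j) (hx1 n j) (hbd (j + 1)) (fun ω => ?_)
        · simpa [hn.ne'] using (hUsum n ω).div_const ((n : ℝ) + 1)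
        · have h1 := (hxsum n (j + 1) ω).div_const ((n : ℝ) + 1)
          rw [mul_div_cancel_left₀ _ hn.ne'] at h1
          simpa only [div_mul_eq_mul_div] using h1
      have hmul1 : ∀ a b : ℝ, |a| ≤ 1 → |b| ≤ 1 → |a * b| ≤ 1 := fun a b ha hb => by
        rw [abs_mul]; exact mul_le_one₀ ha (abs_nonneg b) hb
      have hi1 : Integrable (fun ω => x n j ω * h (j + 1) (Z n ω)) μ :=
        hbdint _ ((hxm n j).mul (hgm n _)) fun ω => hmul1 _ _ (hx1 n j ω) (hbd _ _)
      have hi2 : Integrable (fun ω => x n j ω * x n (j + 1) ω) μ :=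
        hbdint _ ((hxm n j).mul (hxm n _)) fun ω => hmul1 _ _ (hx1 n j ω) (hx1 _ _ _)
      have hup : (n + 2 : ℝ) ^ 2 * ∫ ω, x (n + 1) j ω ^ 2 ∂μ ≤
          (n + 1) ^ 2 * ∫ ω, x n j ω ^ 2 ∂μ
            + 2 * (n + 1) * ∫ ω, x n j ω * h (j + 1) (Z n ω) ∂μ + 1 := by
        have hA : Integrable (fun ω => (n + 1 : ℝ) ^ 2 * x n j ω ^ 2) μ :=
          (hsqint n j).const_mul _
        have hB : Integrable (fun ω => 2 * (n + 1 : ℝ) * (x n j ω * h (j + 1) (Z n ω))) μ :=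
          hi1.const_mul _
        have hAB : Integrable (fun ω => (n + 1 : ℝ) ^ 2 * x n j ω ^ 2
            + 2 * (n + 1) * (x n j ω * h (j + 1) (Z n ω))) μ := hA.add hB
        have e : ∫ ω, ((n + 1 : ℝ) ^ 2 * x n j ω ^ 2
            + 2 * (n + 1) * (x n j ω * h (j + 1) (Z n ω)) + 1) ∂μ =
            (n + 1) ^ 2 * ∫ ω, x n j ω ^ 2 ∂μ
            + 2 * (n + 1) * ∫ ω, x n j ω * h (j + 1) (Z n ω) ∂μ + 1 := by
          rw [integral_add hAB (integrable_const _), integral_add hA hB,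
            integral_const_mul, integral_const_mul]
          simp
        rw [← e, ← integral_const_mul]
        refine integral_mono ((hsqint _ j).const_mul _)
          (hAB.add (integrable_const _)) fun ω => ?_
        have h1 := hxrec n j ω
        have h2 := (abs_le.1 (hsq1 _ (hbd (j + 1) (Z n ω)))).2
        have h3 : (n + 2 : ℝ) ^ 2 * x (n + 1) j ω ^ 2
            = ((n + 1) * x n j ω + h (j + 1) (Z n ω)) ^ 2 := by rw [← h1]; ring
        change (n + 2 : ℝ) ^ 2 * x (n + 1) j ω ^ 2 ≤ _
        rw [h3]
        nlinarith
      have hyoung : 2 * ∫ ω, x n j ω * x n (j + 1) ω ∂μ ≤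
          ∫ ω, x n j ω ^ 2 ∂μ + ∫ ω, x n (j + 1) ω ^ 2 ∂μ := by
        rw [← integral_const_mul, ← integral_add (hsqint _ _) (hsqint _ _)]
        refine integral_mono (hi2.const_mul _) ((hsqint _ _).add (hsqint _ _)) fun ω => ?_
        have := two_mul_le_add_sq (x n j ω) (x n (j + 1) ω)
        simpa [mul_assoc] using this
      have hnext : 0 ≤ ∫ ω, x n (j + 1) ω ^ 2 ∂μ := integral_nonneg fun ω => sq_nonneg _
      rw [hcross] at hup
      have hn : (0 : ℝ) ≤ n := n.cast_nonneg
      have hrhs : ((n + 1) * ∫ ω, x n j ω ^ 2 ∂μ + ∫ ω, x n (j + 1) ω ^ 2 ∂μ) / (n + 2 : ℝ)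
          + 1 / (n + 2 : ℝ) ^ 2 = ((n + 2) * ((n + 1) * ∫ ω, x n j ω ^ 2 ∂μ
            + ∫ ω, x n (j + 1) ω ^ 2 ∂μ) + 1) / (n + 2 : ℝ) ^ 2 := by
        field_simp
      change ∫ ω, x (n + 1) j ω ^ 2 ∂μ ≤ _
      rw [hrhs, le_div_iff₀ (by positivity)]
      nlinarith
    · have := tendsto_integral_of_dominated_convergence (μ := μ)
        (F := fun j ω => x n j ω ^ 2) (f := fun _ => 0) (fun _ => 1)
        (fun j => (hsqint n j).aestronglyMeasurable) (integrable_const 1)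
        (fun j => .of_forall fun ω => hsq1 _ (hx1 n j ω))
        (.of_forall fun ω => by simpa using (hxlim n ω).pow 2)
      simpa using this
  have hmeas : ∀ n s, Measurable fun ω => U n ω s := fun n s =>
    (hU_past n s).mono (hpast n) le_rfl
  have hdev : ∀ n s, Measurable fun ω => U n ω s / (n + 1 : ℝ) - π s := fun n s =>
    ((hmeas n s).div_const _).sub_const _
  have hmem : ∀ n s, MemLp (fun ω => U n ω s / (n + 1 : ℝ) - π s) 2 μ := fun n s => by
    refine MemLp.of_bound (hdev n s).aestronglyMeasurable (1 + ‖π s‖) (.of_forall fun ω => ?_)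
    have hn : (0 : ℝ) < n + 1 := by positivity
    have h0 := hUnn n ω s
    have h1 := le_hasSum (hUsum n ω) s fun t _ => hUnn n ω t
    refine (norm_sub_le _ _).trans ?_
    gcongr
    rw [Real.norm_of_nonneg (by positivity), div_le_one hn]
    exact h1
  refine ⟨fun s => ?_, fun s => ?_⟩
  · refine tendstoInMeasure_of_tendsto_eLpNorm (p := 2) (by norm_num)
      (fun n => ((hmeas n s).div_const _).aestronglyMeasurable)
      aestronglyMeasurable_const ?_
    have hn : ∀ n : ℕ, eLpNorm ((fun ω => U n ω s / (n + 1 : ℝ)) - fun _ => π s) 2 μ =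
        ENNReal.ofReal ((∫ ω, (U n ω s / (n + 1 : ℝ) - π s) ^ 2 ∂μ) ^ (2⁻¹ : ℝ)) := fun n => by
      change eLpNorm (fun ω => U n ω s / (n + 1 : ℝ) - π s) 2 μ = _
      have := (hmem n s).eLpNorm_eq_integral_rpow_norm (by norm_num) (by norm_num)
      simpa using this
    simp_rw [hn]
    have h1 := (L2 s).rpow_const (p := (2⁻¹ : ℝ)) (Or.inr (by norm_num))
    simpa using ENNReal.tendsto_ofReal h1
  · have hmean : ∀ n : ℕ, (∫ ω, U n ω s ∂μ) / (n + 1 : ℝ) - π s =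
        ∫ ω, (U n ω s / (n + 1 : ℝ) - π s) ∂μ := fun n => by
      have hi : Integrable (fun ω => U n ω s / (n + 1 : ℝ)) μ :=
        (((hmem n s).integrable (by norm_num)).add (integrable_const (π s))).congr
          (.of_forall fun ω => by simp)
      rw [integral_sub hi (integrable_const _), integral_div]
      simp
    rw [← tendsto_sub_nhds_zero_iff]
    have hsq : Tendsto (fun n : ℕ => ((∫ ω, U n ω s ∂μ) / (n + 1 : ℝ) - π s) ^ 2)
        atTop (nhds 0) := by
      refine squeeze_zero (fun n => sq_nonneg _) (fun n => ?_) (L2 s)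
      rw [hmean]
      have h1 := variance_eq_sub (hmem n s)
      have h2 := variance_nonneg (fun ω => U n ω s / (n + 1 : ℝ) - π s) μ
      simp only [Pi.pow_apply] at h1
      linarith
    have h3 := hsq.sqrt
    simp only [Real.sqrt_sq_eq_abs, Real.sqrt_zero] at h3
    exact (tendsto_zero_iff_abs_tendsto_zero _).2 h3
end

section
/- Let the increments of a random walk on ℤ^d have distribution p with mean μ and positive definite second moment matrix Σ. In the associated balanced urn model (replacement kernel R(u, {v}) = p(v − u)), the randomly drawn color satisfies (Z_n − μ log n)/√(log n) ⇒ Normal_d(0, Σ). -/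
open MeasureTheory ProbabilityTheory Filter Finset Classical
open MeasureTheory ProbabilityTheory Filter Finset Classical

/-- The sums `∑ 1 / (k + 2)` grow like `log n`, up to a convergent correction. -/
lemma tendsto_sum_one_div_add_two_sub_log :
    Tendsto (fun n : ℕ ↦ (∑ k ∈ range n, 1 / ((k : ℝ) + 2)) - Real.log n) atTop
      (nhds (Real.eulerMascheroniConstant - 1)) := by
  have hsum (n : ℕ) :
      ∑ k ∈ range n, 1 / ((k : ℝ) + 2) = (harmonic n : ℝ) - 1 + 1 / ((n : ℝ) + 1) := by
    induction n with
    | zero => simp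
    | succ n ih =>
      rw [sum_range_succ, ih, harmonic_succ]
      push_cast
      rw [one_div ((n : ℝ) + 1)]
      ring
  have h := (Real.tendsto_harmonic_sub_log.sub_const 1).add
    (tendsto_one_div_add_atTop_nhds_zero_nat (𝕜 := ℝ))
  rw [add_zero] at h
  refine h.congr fun n ↦ ?_
  rw [hsum]
  ring

lemma tendsto_exp_neg_mul_log_mul_prod {w : ℕ → ℂ} (hw : Tendsto w atTop (nhds 0)) :
    Tendsto (fun n : ℕ ↦ Complex.exp (-(w n * (Real.log n : ℝ))) *
      ∏ k ∈ range n, (1 + w n / ((k : ℂ) + 2))) atTop (nhds 1) := by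
  set H : ℕ → ℝ := fun n ↦ ∑ k ∈ range n, 1 / ((k : ℝ) + 2) with hH
  have hsummable : Summable fun k : ℕ ↦ 1 / ((k : ℝ) + 2) ^ 2 := by
    have := (summable_nat_add_iff 2).2 (Real.summable_one_div_nat_pow.2 one_lt_two)
    simpa using this
  set C : ℝ := ∑' k : ℕ, 1 / ((k : ℝ) + 2) ^ 2 with hC
  have hnorm (z : ℂ) (k : ℕ) : ‖z / ((k : ℂ) + 2)‖ = ‖z‖ * (1 / ((k : ℝ) + 2)) := by
    rw [norm_div, ← Nat.cast_ofNat (n := 2), ← Nat.cast_add, Complex.norm_natCast]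
    push_cast
    ring
  have hone : ∀ᶠ n in atTop, ‖w n‖ < 1 := by
    have := hw.norm
    rw [norm_zero] at this
    exact this.eventually_lt_const one_pos
  have hhalf {z : ℂ} (hz : ‖z‖ < 1) (k : ℕ) : ‖z / ((k : ℂ) + 2)‖ ≤ 1 / 2 := by
    rw [hnorm]
    have : 1 / ((k : ℝ) + 2) ≤ 1 / 2 := by gcongr; linarith [k.cast_nonneg (α := ℝ)]
    nlinarith [norm_nonneg z, show 0 ≤ 1 / ((k : ℝ) + 2) by positivity]
  have herr : Tendsto (fun n ↦ (∑ k ∈ range n, Complex.log (1 + w n / ((k : ℂ) + 2))) -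
      w n * (H n : ℝ)) atTop (nhds 0) := by
    refine squeeze_zero_norm' (a := fun n ↦ ‖w n‖ ^ 2 * C) ?_ ?_
    · filter_upwards [hone] with n hn
      have : w n * (H n : ℝ) = ∑ k ∈ range n, w n / ((k : ℂ) + 2) := by
        rw [hH]
        push_cast
        rw [mul_sum]
        exact sum_congr rfl fun k _ ↦ by ring
      rw [this, ← sum_sub_distrib]
      calc _ ≤ ∑ k ∈ range n, ‖w n‖ ^ 2 * (1 / ((k : ℝ) + 2) ^ 2) := by
            refine norm_sum_le_of_le _ fun k _ ↦ ?_
            have hk := hhalf hn k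
            refine (Complex.norm_log_one_add_sub_self_le (by linarith)).trans ?_
            have hinv : (1 - ‖w n / ((k : ℂ) + 2)‖)⁻¹ ≤ 2 := by
              rw [inv_le_comm₀ (by linarith) two_pos]
              linarith
            calc _ ≤ ‖w n / ((k : ℂ) + 2)‖ ^ 2 * 2 / 2 := by gcongr
              _ = _ := by rw [hnorm, mul_pow, one_div_pow, mul_div_cancel_right₀ _ two_ne_zero]
        _ = ‖w n‖ ^ 2 * ∑ k ∈ range n, 1 / ((k : ℝ) + 2) ^ 2 := by rw [mul_sum]
        _ ≤ _ := by
            gcongr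
            exact hsummable.sum_le_tsum _ fun k _ ↦ by positivity
    · simpa using (hw.norm.pow 2).mul_const C
  have hcorr : Tendsto (fun n ↦ w n * ((H n - Real.log n : ℝ) : ℂ)) atTop (nhds 0) := by
    have := hw.mul ((Complex.continuous_ofReal.tendsto _).comp tendsto_sum_one_div_add_two_sub_log)
    rwa [zero_mul] at this
  have hexp := (Complex.continuous_exp.tendsto _).comp (herr.add hcorr)
  rw [add_zero, Complex.exp_zero] at hexp
  refine hexp.congr' ?_
  filter_upwards [hone] with n hn
  have hprod : ∏ k ∈ range n, (1 + w n / ((k : ℂ) + 2)) =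
      Complex.exp (∑ k ∈ range n, Complex.log (1 + w n / ((k : ℂ) + 2))) := by
    rw [Complex.exp_sum]
    refine prod_congr rfl fun k _ ↦ (Complex.exp_log fun h ↦ ?_).symm
    have hk := hhalf hn k
    rw [eq_neg_of_add_eq_zero_right h] at hk
    norm_num at hk
  rw [Function.comp_apply, hprod, ← Complex.exp_add]
  congr 1
  push_cast
  ring

/-- The limit of `exp (-i t m √(log n))` times the product of the factors
`1 + (φ (t / √(log n)) - 1) / (k + 2)`, where `φ` is twice differentiable at `0`. -/
lemma tendsto_exp_mul_prod_of_isLittleO {φ : ℝ → ℂ} {m s : ℝ}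
    (hφ : (fun t : ℝ ↦ φ t - (1 + m * t * Complex.I - s * t ^ 2 / 2)) =o[nhds 0]
      fun t : ℝ ↦ t ^ 2) (t : ℝ) :
    Tendsto (fun n : ℕ ↦ Complex.exp (-(t / √(Real.log n) * (m * Real.log n) * Complex.I)) *
      ∏ k ∈ range n, (1 + (φ (t / √(Real.log n)) - 1) / ((k : ℂ) + 2))) atTop
      (nhds (Complex.exp (-(s * t ^ 2 / 2)))) := by
  have hlog : Tendsto (fun n : ℕ ↦ Real.log n) atTop atTop :=
    Real.tendsto_log_atTop.comp tendsto_natCast_atTop_atTop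
  have hτ : Tendsto (fun n : ℕ ↦ t / √(Real.log n)) atTop (nhds 0) :=
    tendsto_const_nhds.div_atTop (Real.tendsto_sqrt_atTop.comp hlog)
  set w : ℕ → ℂ := fun n ↦ φ (t / √(Real.log n)) - 1 with hwdef
  have hw : Tendsto w atTop (nhds 0) := by
    have hsq : Tendsto (fun x : ℝ ↦ x ^ 2) (nhds 0) (nhds 0) := by
      simpa using (continuous_pow 2).tendsto (0 : ℝ)
    have h1 := hφ.trans_tendsto hsq
    have h2 : Tendsto (fun x : ℝ ↦ (m * x * Complex.I - s * x ^ 2 / 2 : ℂ)) (nhds 0) (nhds 0) := by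
      have : Continuous fun x : ℝ ↦ (m * x * Complex.I - s * x ^ 2 / 2 : ℂ) := by fun_prop
      simpa using this.tendsto 0
    have h3 := (h1.add h2).comp hτ
    rw [add_zero] at h3
    refine h3.congr fun n ↦ ?_
    simp only [hwdef, Function.comp_apply]
    ring
  have hrem : Tendsto (fun n : ℕ ↦ w n * (Real.log n : ℝ) -
      t / √(Real.log n) * (m * Real.log n) * Complex.I + s * t ^ 2 / 2) atTop (nhds 0) := by
    have hO : (fun n : ℕ ↦ ((Real.log n : ℝ) : ℂ)) =O[atTop] fun n : ℕ ↦ Real.log n :=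
      Asymptotics.isBigO_of_le _ fun n ↦ (Complex.norm_real _).le
    have hpos : ∀ᶠ n : ℕ in atTop, 0 < Real.log n := hlog.eventually_gt_atTop 0
    have hright : (fun n : ℕ ↦ (t / √(Real.log n)) ^ 2 * Real.log n) =ᶠ[atTop]
        fun _ ↦ t ^ 2 := by
      filter_upwards [hpos] with n hn
      rw [div_pow, Real.sq_sqrt hn.le, div_mul_cancel₀ _ hn.ne']
    have hlittle := (((hφ.comp_tendsto hτ).mul_isBigO hO).trans_eventuallyEq hright).trans_isBigO
      (Asymptotics.isBigO_const_const (t ^ 2) (one_ne_zero (α := ℝ)) atTop)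
    refine ((Asymptotics.isLittleO_one_iff ℝ).1 hlittle).congr' ?_
    filter_upwards [hpos] with n hn
    have hsq : ((√(Real.log n) : ℝ) : ℂ) ^ 2 = (Real.log n : ℝ) := by
      rw [← Complex.ofReal_pow, Real.sq_sqrt hn.le]
    have hne : ((√(Real.log n) : ℝ) : ℂ) ≠ 0 :=
      Complex.ofReal_ne_zero.2 (Real.sqrt_pos.2 hn).ne'
    simp only [hwdef, Function.comp_apply, Complex.ofReal_div]
    rw [← hsq]
    field_simp
    ring
  have hmain := (tendsto_exp_neg_mul_log_mul_prod hw).mul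
    ((Complex.continuous_exp.tendsto _).comp (hrem.sub_const ((s : ℂ) * t ^ 2 / 2)))
  rw [zero_sub, one_mul] at hmain
  refine hmain.congr fun n ↦ ?_
  rw [Function.comp_apply, mul_right_comm, ← Complex.exp_add]
  congr 2
  ring

section Urn

variable {d : ℕ} {Ω : Type*} [MeasurableSpace Ω] {μ : Measure Ω} [IsProbabilityMeasure μ]
  {Z : ℕ → Ω → (Fin d → ℤ)}

/-- The one-step recursion for the law of the drawn color. -/
lemma measureReal_draw_succ {p u0 : (Fin d → ℤ) → ℝ} (hp : ∀ v, 0 ≤ p v) (hp1 : ∀ v, p v ≤ 1)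
    (hZ : ∀ n, Measurable (Z n)) {U : ℕ → Ω → (Fin d → ℤ) → ℝ}
    (hU0 : ∀ ω, U 0 ω = u0) (hUrec : ∀ n ω s, U (n + 1) ω s = U n ω s + p (s - Z n ω))
    (hdraw : ∀ n s, μ.real {ω | Z n ω = s} = ∫ ω, U n ω s / (n + 1 : ℝ) ∂μ)
    (n : ℕ) (s : Fin d → ℤ) :
    ((n : ℝ) + 2) * μ.real {ω | Z (n + 1) ω = s} =
      (n + 1) * μ.real {ω | Z n ω = s} + ∫ ω, p (s - Z n ω) ∂μ := by
  have hpint (n : ℕ) : Integrable (fun ω ↦ p (s - Z n ω)) μ := by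
    refine .of_bound (C := 1) ?_ (ae_of_all _ fun ω ↦ ?_)
    · exact ((measurable_of_countable fun v ↦ p (s - v)).comp (hZ n)).aestronglyMeasurable
    · rw [Real.norm_of_nonneg (hp _)]
      exact hp1 _
  have hUint (n : ℕ) : Integrable (fun ω ↦ U n ω s) μ := by
    induction n with
    | zero => simp [hU0]
    | succ n ih =>
      simp_rw [hUrec]
      exact ih.add (hpint n)
  rw [hdraw, hdraw, integral_div, integral_div]
  simp_rw [hUrec]
  rw [integral_add (hUint n) (hpint n)]
  push_cast
  field_simp
  ring

/-- The one-step recursion for the characteristic function of the drawn color. -/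
lemma integral_char_draw_succ {p : (Fin d → ℤ) → ℝ} (hp : ∀ v, 0 ≤ p v) (hpsum : HasSum p 1)
    (hp1 : ∀ v, p v ≤ 1) (hZ : ∀ n, Measurable (Z n))
    (hrec : ∀ (n : ℕ) s, ((n : ℝ) + 2) * μ.real {ω | Z (n + 1) ω = s} =
      (n + 1) * μ.real {ω | Z n ω = s} + ∫ ω, p (s - Z n ω) ∂μ)
    {χ : (Fin d → ℤ) → ℂ} (hχ : ∀ v, ‖χ v‖ = 1) (hadd : ∀ v w, χ (v + w) = χ v * χ w) (n : ℕ) :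
    ((n : ℂ) + 2) * ∫ ω, χ (Z (n + 1) ω) ∂μ =
      (n + 1 + ∑' v, (p v : ℂ) * χ v) * ∫ ω, χ (Z n ω) ∂μ := by
  have hlaw (n : ℕ) :
      HasSum (fun s ↦ (μ.real {ω | Z n ω = s} : ℂ) * χ s) (∫ ω, χ (Z n ω) ∂μ) := by
    have : IsProbabilityMeasure (μ.map (Z n)) :=
      Measure.isProbabilityMeasure_map (hZ n).aemeasurable
    have hint : Integrable χ (μ.map (Z n)) :=
      .of_bound (C := 1) (measurable_of_countable χ).aestronglyMeasurable
        (ae_of_all _ fun v ↦ (hχ v).le)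
    rw [← integral_map (hZ n).aemeasurable (measurable_of_countable χ).aestronglyMeasurable]
    rw [← Measure.sum_smul_dirac (μ.map (Z n))] at hint ⊢
    refine (hasSum_integral_measure hint).congr_fun fun s ↦ ?_
    rw [integral_smul_measure, integral_dirac, Measure.map_apply (hZ n) (measurableSet_singleton s)]
    rfl
  have hshift (a : Fin d → ℤ) :
      HasSum (fun s ↦ (p (s - a) : ℂ) * χ s) ((∑' v, (p v : ℂ) * χ v) * χ a) := by
    have hs : Summable fun v ↦ (p v : ℂ) * χ v := by
      refine .of_norm (hpsum.summable.congr fun v ↦ ?_)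
      rw [norm_mul, hχ, mul_one, Complex.norm_real, Real.norm_of_nonneg (hp v)]
    rw [← (Equiv.addRight a).hasSum_iff]
    refine (hs.hasSum.mul_right (χ a)).congr_fun fun v ↦ ?_
    simp [hadd, mul_assoc]
  have hconv : HasSum (fun s ↦ ((∫ ω, p (s - Z n ω) ∂μ : ℝ) : ℂ) * χ s)
      ((∑' v, (p v : ℂ) * χ v) * ∫ ω, χ (Z n ω) ∂μ) := by
    have hmass (n : ℕ) : Summable fun s ↦ μ.real {ω | Z n ω = s} :=
      (hlaw n).summable.norm.congr fun s ↦ by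
        rw [norm_mul, hχ, mul_one, Complex.norm_real, Real.norm_of_nonneg measureReal_nonneg]
    have hsum : Summable fun s ↦ ∫ ω, p (s - Z n ω) ∂μ :=
      (((hmass (n + 1)).mul_left ((n : ℝ) + 2)).sub ((hmass n).mul_left ((n : ℝ) + 1))).congr
        fun s ↦ by rw [hrec]; ring
    have hint (s : Fin d → ℤ) : Integrable (fun ω ↦ (p (s - Z n ω) : ℂ) * χ s) μ := by
      refine .of_bound (C := 1) ?_ (ae_of_all _ fun ω ↦ ?_)
      · exact ((measurable_of_countable fun v ↦ (p (s - v) : ℂ) * χ s).comp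
          (hZ n)).aestronglyMeasurable
      · rw [norm_mul, hχ, mul_one, Complex.norm_real, Real.norm_of_nonneg (hp _)]
        exact hp1 _
    have h := hasSum_integral_of_summable_integral_norm hint (hsum.congr fun s ↦ by
      simp_rw [norm_mul, hχ, mul_one, Complex.norm_real, Real.norm_of_nonneg (hp _)])
    simp_rw [(hshift _).tsum_eq, integral_const_mul, integral_mul_const, integral_complex_ofReal]
      at h
    exact h
  have h1 := (hlaw (n + 1)).mul_left ((n : ℂ) + 2)
  have h2 := ((hlaw n).mul_left ((n : ℂ) + 1)).add hconv
  rw [add_mul (n + 1 : ℂ)]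
  refine h1.unique (h2.congr_fun fun s ↦ ?_)
  rw [← mul_assoc, ← mul_assoc, ← add_mul]
  congr 1
  exact_mod_cast hrec n s

/-- The characteristic function of the projected drawn color is that of the initial color times
a product over the draws. -/
lemma integral_char_draw_eq_prod {p : (Fin d → ℤ) → ℝ} (hp : ∀ v, 0 ≤ p v) (hpsum : HasSum p 1)
    (hp1 : ∀ v, p v ≤ 1) (hZ : ∀ n, Measurable (Z n))
    (hrec : ∀ (n : ℕ) s, ((n : ℝ) + 2) * μ.real {ω | Z (n + 1) ω = s} =
      (n + 1) * μ.real {ω | Z n ω = s} + ∫ ω, p (s - Z n ω) ∂μ)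
    {χ : (Fin d → ℤ) → ℂ} (hχ : ∀ v, ‖χ v‖ = 1) (hadd : ∀ v w, χ (v + w) = χ v * χ w) (n : ℕ) :
    ∫ ω, χ (Z n ω) ∂μ = (∫ ω, χ (Z 0 ω) ∂μ) *
      ∏ k ∈ range n, (1 + ((∑' v, (p v : ℂ) * χ v) - 1) / ((k : ℂ) + 2)) := by
  induction n with
  | zero => simp
  | succ n ih =>
    have hne : (n : ℂ) + 2 ≠ 0 := by exact_mod_cast (n + 1).succ_ne_zero
    rw [prod_range_succ, ← mul_assoc, ← ih]
    refine mul_left_cancel₀ hne ?_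
    rw [integral_char_draw_succ hp hpsum hp1 hZ hrec hχ hadd]
    field_simp
    ring

end Urn

/-- Second-order Taylor expansion of the characteristic function of a random variable with a
finite second moment. -/
lemma isLittleO_charFun_map_sub_taylor_two {α : Type*} [MeasurableSpace α] {P : Measure α}
    [IsProbabilityMeasure P] {X : α → ℝ} (hX : AEMeasurable X P) (hX2 : MemLp X 2 P) {m s : ℝ}
    (hm : ∫ a, X a ∂P = m) (hs : ∫ a, X a ^ 2 ∂P = s) :
    (fun t : ℝ ↦ charFun (P.map X) t - (1 + m * t * Complex.I - s * t ^ 2 / 2)) =o[nhds 0]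
      fun t : ℝ ↦ t ^ 2 := by
  have : IsProbabilityMeasure (P.map X) := Measure.isProbabilityMeasure_map hX
  have hid : MemLp id 2 (P.map X) := (memLp_map_measure_iff (by fun_prop) hX).2 hX2
  have h := taylor_isLittleO_univ (n := 2) (x₀ := 0) (contDiff_charFun (n := 2) hid)
  simp_rw [taylorWithinEval_charFun_two_zero hX hid, sub_zero, Pi.pow_apply, hm, hs] at h
  exact h

/-- Balanced urn on the colors `ℤ^d` associated with a random
walk: the replacement kernel is `R u {v} = p (v - u)` where `p` is the
increment distribution, with mean `μvec` and positive definite second moment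
matrix `Σ`.  Then the drawn color satisfies
`(Z n - μvec·log n)/√(log n) ⇒ Normal_d(0, Σ)`, expressed via the Cramér–Wold
device through all one-dimensional projections `u`. -/
theorem random_walk_urn_clt
    (d : ℕ)
    (p : (Fin d → ℤ) → ℝ) (hpnonneg : ∀ v, 0 ≤ p v) (hpsum : HasSum p 1)
    (muvec : Fin d → ℝ)
    (hmean : ∀ l, HasSum (fun v : Fin d → ℤ => p v * (v l : ℝ)) (muvec l))
    (Sig : Matrix (Fin d) (Fin d) ℝ)
    (hSig : ∀ l l', HasSum (fun v : Fin d → ℤ => p v * ((v l : ℝ) * (v l' : ℝ))) (Sig l l'))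
    (hSigposdef : Sig.PosDef)
    (R : (Fin d → ℤ) → (Fin d → ℤ) → ℝ) (hR : ∀ u v, R u v = p (v - u))
    {Ω : Type*} [MeasurableSpace Ω] (μ : Measure Ω) [IsProbabilityMeasure μ]
    (Z : ℕ → Ω → (Fin d → ℤ)) (hZmeas : ∀ n, Measurable (Z n))
    (u0 : (Fin d → ℤ) → ℝ) (hu0nonneg : ∀ s, 0 ≤ u0 s) (hu0sum : HasSum u0 1)
    (U : ℕ → Ω → (Fin d → ℤ) → ℝ)
    (hU0 : ∀ ω, U 0 ω = u0)
    (hUrec : ∀ n ω s, U (n + 1) ω s = U n ω s + R (Z n ω) s)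
    (hdraw : ∀ n : ℕ, ∀ s : Fin d → ℤ, ∀ A : Set Ω,
      MeasurableSet[⨆ k ∈ range n, MeasurableSpace.comap (Z k) inferInstance] A →
      (μ (A ∩ {ω | Z n ω = s})).toReal = ∫ ω in A, U n ω s / (n + 1 : ℝ) ∂μ) :
    ∀ u : Fin d → ℝ, ∀ ν : ℕ → ProbabilityMeasure ℝ,
      (∀ n : ℕ, (ν n : Measure ℝ)
        = μ.map (fun ω =>
            (∑ l : Fin d, u l * ((Z n ω l : ℝ) - muvec l * Real.log n))
              / Real.sqrt (Real.log n))) →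
      Tendsto ν atTop
        (nhds ⟨gaussianReal 0
          ((∑ l : Fin d, ∑ l' : Fin d, u l * Sig l l' * u l').toNNReal),
          inferInstance⟩) := by
  intro u ν hν
  simp_rw [hR] at hUrec
  have hp1 (v : Fin d → ℤ) : p v ≤ 1 := le_hasSum hpsum v fun w _ ↦ hpnonneg w
  have hrec := measureReal_draw_succ hpnonneg hp1 hZmeas hU0 hUrec fun n s ↦ by
    simpa [measureReal_def] using hdraw n s Set.univ MeasurableSet.univ
  set X : (Fin d → ℤ) → ℝ := fun v ↦ ∑ l, u l * (v l : ℝ) with hX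
  have hXmeas : Measurable X := measurable_of_countable X
  set m : ℝ := ∑ l, u l * muvec l with hm
  set s : ℝ := ∑ l : Fin d, ∑ l' : Fin d, u l * Sig l l' * u l' with hs
  have hXmean : HasSum (fun v ↦ p v * X v) m := by
    refine (hasSum_sum fun l (_ : l ∈ univ) ↦ (hmean l).mul_left (u l)).congr_fun fun v ↦ ?_
    simp only [hX, mul_sum]
    exact sum_congr rfl fun l _ ↦ by ring
  have hXsq : HasSum (fun v ↦ p v * X v ^ 2) s := by
    refine (hasSum_sum fun l (_ : l ∈ univ) ↦ hasSum_sum fun l' (_ : l' ∈ univ) ↦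
      ((hSig l l').mul_left (u l)).mul_right (u l')).congr_fun fun v ↦ ?_
    simp only [hX]
    rw [sq, sum_mul_sum, mul_sum]
    refine sum_congr rfl fun l _ ↦ ?_
    rw [mul_sum]
    exact sum_congr rfl fun l' _ ↦ by ring
  have hs0 : 0 ≤ s := hXsq.nonneg fun v ↦ mul_nonneg (hpnonneg v) (sq_nonneg _)
  set P : Measure (Fin d → ℤ) := Measure.sum fun v ↦ ENNReal.ofReal (p v) • Measure.dirac v with hP
  have : IsProbabilityMeasure P := hpsum.isProbabilityMeasure_sum_dirac hpnonneg
  have hPint (f : (Fin d → ℤ) → ℝ) : ∫ v, f v ∂P = ∑' v, p v * f v := by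
    rw [hP, integral_sum_dirac fun _ ↦ ENNReal.ofReal_ne_top]
    simp_rw [ENNReal.toReal_ofReal (hpnonneg _), smul_eq_mul]
  have hX2 : MemLp X 2 P := by
    rw [memLp_two_iff_integrable_sq hXmeas.aestronglyMeasurable, hP,
      integrable_sum_dirac_iff fun _ ↦ ENNReal.ofReal_ne_top]
    refine hXsq.summable.congr fun v ↦ ?_
    rw [ENNReal.toReal_ofReal (hpnonneg v), Real.norm_of_nonneg (sq_nonneg _)]
  have hφ := isLittleO_charFun_map_sub_taylor_two hXmeas.aemeasurable hX2
    (by rw [hPint, hXmean.tsum_eq]) (by rw [hPint, hXsq.tsum_eq])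
  have hcharP (t : ℝ) :
      charFun (P.map X) t = ∑' v, (p v : ℂ) * Complex.exp (t * X v * Complex.I) := by
    rw [charFun_apply_real, integral_map hXmeas.aemeasurable (by fun_prop), hP,
      integral_sum_dirac fun _ ↦ ENNReal.ofReal_ne_top]
    simp_rw [ENNReal.toReal_ofReal (hpnonneg _), Complex.real_smul]
  have hprod (t : ℝ) := integral_char_draw_eq_prod hpnonneg hpsum hp1 hZmeas hrec
    (χ := fun v ↦ Complex.exp (t * X v * Complex.I))
    (fun v ↦ by rw [← Complex.ofReal_mul, Complex.norm_exp_ofReal_mul_I])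
    (fun v w ↦ by
      rw [← Complex.exp_add]
      simp only [hX, Pi.add_apply, Int.cast_add, mul_add, sum_add_distrib, Complex.ofReal_add,
        add_mul])
  simp_rw [← hcharP] at hprod
  have hXZ (n : ℕ) : Measurable fun ω ↦ X (Z n ω) := hXmeas.comp (hZmeas n)
  have hinit : Tendsto (fun t : ℝ ↦ ∫ ω, Complex.exp (t * X (Z 0 ω) * Complex.I) ∂μ) (nhds 0)
      (nhds 1) := by
    have : IsProbabilityMeasure (μ.map fun ω ↦ X (Z 0 ω)) :=
      Measure.isProbabilityMeasure_map (hXZ 0).aemeasurable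
    have h := (continuous_charFun (μ := μ.map fun ω ↦ X (Z 0 ω))).tendsto 0
    rw [charFun_zero, probReal_univ, Complex.ofReal_one] at h
    refine h.congr fun t ↦ ?_
    rw [charFun_apply_real, integral_map (hXZ 0).aemeasurable (by fun_prop)]
  refine ProbabilityMeasure.tendsto_iff_tendsto_charFun.2 fun t ↦ ?_
  have hτ : Tendsto (fun n : ℕ ↦ t / √(Real.log n)) atTop (nhds 0) :=
    tendsto_const_nhds.div_atTop (Real.tendsto_sqrt_atTop.comp
      (Real.tendsto_log_atTop.comp tendsto_natCast_atTop_atTop))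
  have hlim := (hinit.comp hτ).mul (tendsto_exp_mul_prod_of_isLittleO hφ t)
  rw [one_mul] at hlim
  have hgauss : charFun (gaussianReal 0 s.toNNReal) t = Complex.exp (-(s * t ^ 2 / 2)) := by
    rw [charFun_gaussianReal]
    simp [Real.coe_toNNReal _ hs0]
  rw [ProbabilityMeasure.coe_mk, hgauss]
  refine hlim.congr fun n ↦ ?_
  have hproj (ω : Ω) : (∑ l : Fin d, u l * ((Z n ω l : ℝ) - muvec l * Real.log n)) =
      X (Z n ω) - m * Real.log n := by
    simp only [hX, hm, mul_sub, sum_sub_distrib, sum_mul, mul_assoc]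
  simp_rw [hν, hproj]
  rw [charFun_apply_real (t := t), integral_map (by fun_prop) (by fun_prop)]
  have hsplit (ω : Ω) :
      Complex.exp (t * ((X (Z n ω) - m * Real.log n) / √(Real.log n) : ℝ) * Complex.I) =
        Complex.exp (-(t / √(Real.log n) * (m * Real.log n) * Complex.I)) *
          Complex.exp ((t / √(Real.log n) : ℝ) * X (Z n ω) * Complex.I) := by
    rw [← Complex.exp_add]
    push_cast
    ring_nf
  simp_rw [hsplit, integral_const_mul]
  rw [hprod, Function.comp_apply]
  ring
end
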